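/- arXiv:1306.2774 — 2 statements merged into one kernel-verified Lean document; each statement's English description precedes it below -/
import Mathlib

section
/- Let X be a chain and let α, β ∈ O(X). Then α 𝓓 β in O(X) if and only if there exists an order-isomorphism θ : range(α) → range(β) that is bicompletable in O(X), i.e., such that both θ and θ⁻¹ extend to order-preserving self-maps of X. -/
/-- If the range of `γ` lies in the range of an order-preserving map `β` defined on a chain, then
`γ` factors through `β` by an order-preserving map. -/
theorem OrderHom.exists_lift_of_range_subset {X Y Z : Type*} [LinearOrder X] [PartialOrder Y]
    [Preorder Z] (β : X →o Y) (γ : Z →o Y) (h : ∀ z, γ z ∈ Set.range β) :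
    ∃ lam : Z →o X, ∀ z, β (lam z) = γ z := by
  let s : Set.range β → X := fun y => y.2.choose
  have hs : ∀ y, β (s y) = y := fun y => y.2.choose_spec
  have hmono : Monotone s := by
    intro y₁ y₂ h₁₂
    by_contra! hlt
    have h₂₁ : y₂ ≤ y₁ := by
      have := β.monotone hlt.le
      rwa [hs, hs] at this
    rw [le_antisymm h₁₂ h₂₁] at hlt
    exact lt_irrefl _ hlt
  exact ⟨⟨fun z => s ⟨γ z, h z⟩, fun _ _ hz => hmono (γ.monotone hz)⟩, fun z => hs _⟩


/-- Green's relation 𝓓 on the monoid `O(X)`: `α 𝓓 β` iff there is an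
order-isomorphism `θ : range α → range β` which is bicompletable in `O(X)`, i.e.
both `θ` and `θ⁻¹` extend to order-preserving self-maps of `X`.
Products are written left-to-right. -/
theorem green_D_on_OX
    {X : Type*} [LinearOrder X] (α β : X →o X) :
    (∃ γ : X →o X,
      ((∃ g : X →o X, ∀ x, g (γ x) = α x) ∧
       (∃ ξ : X →o X, ∀ x, ξ (α x) = γ x)) ∧
      ((∃ lam : X →o X, ∀ x, β (lam x) = γ x) ∧
       (∃ mu : X →o X, ∀ x, γ (mu x) = β x))) ↔
    (∃ e : (Set.range ⇑α) ≃o (Set.range ⇑β),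
      (∃ γ : X →o X, ∀ a : Set.range ⇑α, γ (a : X) = ((e a : Set.range ⇑β) : X)) ∧
      (∃ ξ : X →o X, ∀ b : Set.range ⇑β, ξ (b : X) = ((e.symm b : Set.range ⇑α) : X))) := by
  constructor
  · rintro ⟨γ, ⟨⟨g, hg⟩, ξ, hξ⟩, ⟨lam, hlam⟩, mu, hmu⟩
    have hξβ : ∀ a : Set.range α, ξ a ∈ Set.range β := by
      rintro ⟨_, x, rfl⟩
      exact ⟨lam x, by rw [hlam, hξ]⟩
    have hgα : ∀ b : Set.range β, g b ∈ Set.range α := by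
      rintro ⟨_, x, rfl⟩
      exact ⟨mu x, by rw [← hg, hmu]⟩
    have hgξ : ∀ a : Set.range α, g (ξ a) = a := by
      rintro ⟨_, x, rfl⟩
      rw [hξ, hg]
    have hξg : ∀ b : Set.range β, ξ (g b) = b := by
      rintro ⟨_, x, rfl⟩
      change ξ (g (β x)) = β x
      rw [← hmu, hg, hξ]
    let e : Set.range α ≃ Set.range β :=
      { toFun := fun a => ⟨ξ a, hξβ a⟩
        invFun := fun b => ⟨g b, hgα b⟩
        left_inv := fun a => Subtype.ext (hgξ a)
        right_inv := fun b => Subtype.ext (hξg b) }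
    exact ⟨e.toOrderIso (fun _ _ h => ξ.monotone h) (fun _ _ h => g.monotone h),
      ⟨ξ, fun _ => rfl⟩, ⟨g, fun _ => rfl⟩⟩
  · rintro ⟨e, ⟨ξ, hξ⟩, g, hg⟩
    have hgξ : ∀ x, g (ξ (α x)) = α x := by
      intro x
      have h := hξ ⟨α x, x, rfl⟩
      dsimp only at h
      rw [h, hg, e.symm_apply_apply]
    refine ⟨ξ.comp α, ⟨⟨g, hgξ⟩, ξ, fun _ => rfl⟩,
      OrderHom.exists_lift_of_range_subset β (ξ.comp α) fun x => ?_,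
      OrderHom.exists_lift_of_range_subset (ξ.comp α) β fun x => ?_⟩
    · have h := hξ ⟨α x, x, rfl⟩
      exact h ▸ (e ⟨α x, x, rfl⟩).2
    · obtain ⟨y, hy⟩ := (e.symm ⟨β x, x, rfl⟩).2
      refine ⟨y, ?_⟩
      rw [OrderHom.comp_coe, Function.comp_apply, hy, hξ, e.apply_symm_apply]
end

section
/- Let X and X' be finite chains and let Y and Y' be nonempty subsets of X and X' respectively. Then the semigroups O(X,Y) and O(X',Y') are isomorphic if and only if one of the following holds: (1) |Y| = |Y'| = 1; (2) there exists an order-isomorphism φ : X → X' with φ(Y) = Y'; (3) there exists an order-anti-isomorphism φ : X → X' with φ(Y) = Y'. -/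
/-- The semigroup `O(X,Y)` of order-preserving self-maps of the chain `X` with
range contained in `Y`. -/
def OXY (X : Type*) [LinearOrder X] (Y : Set X) : Type _ :=
  {f : X →o X // ∀ x, f x ∈ Y}

/-- The product of `O(X,Y)`, written left-to-right: `(a * b)(x) = b(a(x))`. -/
def OXY.mul {X : Type*} [LinearOrder X] {Y : Set X} (a b : OXY X Y) : OXY X Y :=
  ⟨b.1.comp a.1, fun x => b.2 (a.1 x)⟩

namespace OXY

variable {X X' : Type*} [LinearOrder X] [LinearOrder X'] {Y : Set X} {Y' : Set X'}

instance : Mul (OXY X Y) := ⟨OXY.mul⟩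

instance : CoeFun (OXY X Y) fun _ => X → X := ⟨fun a => a.1⟩

theorem mul_apply (a b : OXY X Y) (x : X) : (a * b) x = b (a x) := rfl

@[ext]
theorem ext {a b : OXY X Y} (h : ∀ x, a x = b x) : a = b :=
  Subtype.ext (OrderHom.ext _ _ (funext h))

theorem nonempty_mulEquiv_iff :
    Nonempty (OXY X Y ≃* OXY X' Y') ↔
      ∃ Θ : OXY X Y → OXY X' Y', Function.Bijective Θ ∧
        ∀ a b, Θ (OXY.mul a b) = OXY.mul (Θ a) (Θ b) :=
  ⟨fun ⟨e⟩ => ⟨e, e.bijective, map_mul e⟩,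
    fun ⟨Θ, hΘ, hmul⟩ => ⟨{ Equiv.ofBijective Θ hΘ with map_mul' := hmul }⟩⟩

/-- The constant map with value `y`. -/
def const (y : Y) : OXY X Y := ⟨OrderHom.const X y.1, fun _ => y.2⟩

@[simp]
theorem const_apply (y : Y) (x : X) : const y x = y := rfl

theorem mul_const (a : OXY X Y) (y : Y) : a * const y = const y := rfl

theorem const_mul (a : OXY X Y) (y : Y) : const y * a = const ⟨a y, a.2 y⟩ := rfl

theorem const_injective : Function.Injective (const : Y → OXY X Y) := fun y _ h =>
  Subtype.ext (congrArg (fun a : OXY X Y => a y) h)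

/-- Right zeros of `O(X,Y)` are constant maps. -/
theorem exists_eq_const [Nonempty Y] {z : OXY X Y} (hz : ∀ a, a * z = z) :
    ∃ y, z = const y := by
  obtain ⟨y⟩ := ‹Nonempty Y›
  exact ⟨⟨z y, z.2 y⟩, by rw [← const_mul, hz]⟩

/-- An isomorphism permutes the constant maps, and is compatible with evaluation on `Y`. -/
theorem exists_bijective_apply [Nonempty Y] [Nonempty Y'] (Θ : OXY X Y ≃* OXY X' Y') :
    ∃ θ : Y → Y', Function.Bijective θ ∧
      ∀ (a : OXY X Y) (y : Y), Θ a (θ y) = θ ⟨a y, a.2 y⟩ := by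
  have hconst (y : Y) : ∃ y', Θ (const y) = const y' := exists_eq_const fun a => by
    rw [← Θ.apply_symm_apply a, ← map_mul, mul_const]
  choose θ hθ using hconst
  refine ⟨θ, ⟨fun y z h => ?_, fun y' => ?_⟩, fun a y => ?_⟩
  · exact const_injective (Θ.injective (by rw [hθ, hθ, h]))
  · obtain ⟨y, hy⟩ := exists_eq_const (z := Θ.symm (const y')) fun a => by
      rw [← Θ.symm_apply_apply a, ← map_mul, mul_const]
    exact ⟨y, const_injective (by rw [← hθ, ← hy, Θ.apply_symm_apply])⟩
  · have h := congrArg Θ (const_mul a y)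
    rw [map_mul, hθ, hθ, const_mul] at h
    exact congrArg Subtype.val (const_injective h)

/-- The map sending everything below `t` to `p` and everything else to `q`. -/
def step {p q : Y} (hpq : p < q) (t : X) : OXY X Y :=
  ⟨⟨fun x => if x < t then p else q, fun x x' h => by
    have := Subtype.coe_le_coe.2 hpq.le
    dsimp only
    split_ifs with h₁ h₂ h₂
    exacts [le_rfl, this, absurd (h.trans_lt h₂) h₁, le_rfl]⟩,
    fun x => by show (if x < t then (p : X) else q) ∈ Y; split_ifs; exacts [p.2, q.2]⟩

theorem step_apply {p q : Y} (hpq : p < q) (t x : X) :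
    step hpq t x = if x < t then (p : X) else q := rfl

theorem step_injective {p q : Y} (hpq : p < q) : Function.Injective (step hpq) := by
  have key (s t : X) (h : step hpq s = step hpq t) : ¬ s < t := fun hst => by
    have := congrArg (fun a : OXY X Y => a s) h
    simp only [step_apply, lt_irrefl, if_false, hst, if_true] at this
    exact hpq.ne' (Subtype.ext this)
  exact fun s t h => le_antisymm (not_lt.1 (key t s h.symm)) (not_lt.1 (key s t h))

theorem exists_eq_step [Finite X] {p q : Y} (hpq : p < q) {a : OXY X Y}
    (ha : ∀ x, a x = p ∨ a x = q) {x : X} (hx : a x = q) : ∃ t ≤ x, a = step hpq t := by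
  have hpq' : (p : X) < q := hpq
  obtain ⟨t, htx, ht⟩ := (Set.toFinite {x | a x = q}).exists_le_minimal hx
  refine ⟨t, htx, ext fun z => ?_⟩
  rw [step_apply]
  split_ifs with hz
  · exact (ha z).resolve_right fun h => hz.not_ge (ht.2 h hz.le)
  · refine (ha z).resolve_left fun h => ?_
    have := a.1.monotone (not_lt.1 hz)
    exact (h.symm.trans_ge (ht.1.symm.trans_le this)).not_gt hpq'

theorem mul_step_eq_self_iff {p q : Y} (hpq : p < q) (a : OXY X Y) :
    a * step hpq q = a ↔ ∀ x, a x = p ∨ a x = q := by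
  have hpq' : (p : X) < q := hpq
  constructor
  · intro h x
    rw [← h, mul_apply, step_apply]
    split_ifs <;> simp
  · intro h
    ext x
    rw [mul_apply, step_apply]
    rcases h x with h | h <;> simp [h, hpq']

theorem image_step_Iic [Finite X] {p q : Y} (hpq : p < q) (x : X) :
    step hpq '' Set.Iic x = {a : OXY X Y | (∀ z, a z = p ∨ a z = q) ∧ a x = q} := by
  ext a
  constructor
  · rintro ⟨t, ht, rfl⟩
    refine ⟨fun z => ?_, by simp [step_apply, not_lt.2 (Set.mem_Iic.1 ht)]⟩
    rw [step_apply]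
    split_ifs <;> simp
  · rintro ⟨ha, hx⟩
    obtain ⟨t, ht, rfl⟩ := exists_eq_step hpq ha hx
    exact ⟨t, ht, rfl⟩

theorem range_step [Finite X] {p q : Y} (hpq : p < q) :
    Set.range (step hpq) = {a : OXY X Y | (∀ z, a z = p ∨ a z = q) ∧ a ≠ const p} := by
  ext a
  constructor
  · rintro ⟨t, rfl⟩
    refine ⟨fun z => ?_, fun h => ?_⟩
    · rw [step_apply]
      split_ifs <;> simp
    · have := congrArg (fun a : OXY X Y => a t) h
      simp only [step_apply, lt_irrefl, if_false, const_apply] at this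
      exact hpq.ne' (Subtype.ext this)
  · rintro ⟨ha, hne⟩
    obtain ⟨x, hx⟩ : ∃ x, a x = q := by
      by_contra! h
      exact hne (ext fun x => (ha x).resolve_right (h x))
    obtain ⟨t, -, rfl⟩ := exists_eq_step hpq ha hx
    exact ⟨t, rfl⟩

/-- An isomorphism `Θ` inducing `θ` on constants sends maps with values in `{p, q}` to maps with
values in `{θ p, θ q}`. -/
theorem map_values {Θ : OXY X Y ≃* OXY X' Y'} {θ : Y → Y'}
    (hΘ : ∀ (a : OXY X Y) (y : Y), Θ a (θ y) = θ ⟨a y, a.2 y⟩)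
    (hθ : Function.Surjective θ) {p q : Y} (hpq : p < q) {a : OXY X Y}
    (ha : ∀ x, a x = p ∨ a x = q) (x : X') : Θ a x = θ p ∨ Θ a x = θ q := by
  have h := congrArg (fun b : OXY X' Y' => b x)
    (congrArg Θ ((mul_step_eq_self_iff hpq a).2 ha))
  obtain ⟨y, hy⟩ := hθ ⟨Θ a x, (Θ a).2 x⟩
  have hy' : Θ a x = θ y := by rw [hy]
  simp only [map_mul, mul_apply] at h
  rw [hy', hΘ] at h
  rw [hy', ← h]
  have key : (⟨step hpq q y, (step hpq q).2 y⟩ : Y) = p ∨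
      (⟨step hpq q y, (step hpq q).2 y⟩ : Y) = q := by
    simp only [Subtype.ext_iff, step_apply]
    split_ifs <;> simp
  rcases key with h | h <;> simp [h]

theorem values_iff {Θ : OXY X Y ≃* OXY X' Y'} {θ : Y → Y'}
    (hΘ : ∀ (a : OXY X Y) (y : Y), Θ a (θ y) = θ ⟨a y, a.2 y⟩)
    (hθ : Function.Bijective θ) {p q : Y} (hpq : p < q) (hpq' : θ p < θ q) (a : OXY X Y) :
    (∀ x, Θ a x = θ p ∨ Θ a x = θ q) ↔ ∀ x, a x = p ∨ a x = q := by
  refine ⟨fun h => ?_, map_values hΘ hθ.2 hpq⟩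
  let ψ := (Equiv.ofBijective θ hθ).symm
  have hψθ (y : Y) : ψ (θ y) = y := (Equiv.ofBijective θ hθ).symm_apply_apply y
  have hθψ (y : Y') : θ (ψ y) = y := (Equiv.ofBijective θ hθ).apply_symm_apply y
  have hψ (b : OXY X' Y') (y : Y') : Θ.symm b (ψ y) = ψ ⟨b y, b.2 y⟩ := by
    have h := hΘ (Θ.symm b) (ψ y)
    simp only [Θ.apply_symm_apply, hθψ] at h
    simp only [h, Subtype.coe_eta, hψθ]
  have := map_values hψ (Equiv.surjective _) hpq' h
  simpa only [hψθ, Θ.symm_apply_apply] using this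

/-- If the bijection `θ` on constants preserves the order of one pair, then it extends to an
order-isomorphism: both `|X|` and the rank of each `y ∈ Y` can be read off from the semigroup by
counting maps with two values. -/
theorem exists_orderIso [Finite X] [Finite X'] {Θ : OXY X Y ≃* OXY X' Y'} {θ : Y → Y'}
    (hΘ : ∀ (a : OXY X Y) (y : Y), Θ a (θ y) = θ ⟨a y, a.2 y⟩)
    (hθ : Function.Bijective θ) {p q : Y} (hpq : p < q) (hpq' : θ p < θ q) :
    ∃ φ : X ≃o X', φ '' Y = Y' := by
  have hval := values_iff hΘ hθ hpq hpq'
  have hconst : Θ (const p) = const (θ p) := by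
    have h : Θ (const p) = const (θ p) * Θ (const p) := by
      rw [← Θ.apply_symm_apply (const (θ p)), ← map_mul, mul_const]
    rw [h, const_mul]
    congr 1
    exact Subtype.ext (hΘ _ p)
  have hcard : Nat.card X = Nat.card X' := by
    have himg : Θ '' Set.range (step hpq) = Set.range (step hpq') := by
      rw [range_step, range_step]
      ext b
      obtain ⟨a, rfl⟩ := Θ.surjective b
      simp only [Θ.injective.mem_set_image, Set.mem_ofPred_eq, hval, ← hconst,
        Θ.injective.ne_iff]
    rw [← Set.ncard_range_of_injective (step_injective hpq),
      ← Set.ncard_range_of_injective (step_injective hpq'), ← himg,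
      Set.ncard_image_of_injective _ Θ.injective]
  have hrank (y : Y) : (Set.Iic (y : X)).ncard = (Set.Iic (θ y : X')).ncard := by
    have himg : Θ '' (step hpq '' Set.Iic (y : X)) = step hpq' '' Set.Iic (θ y : X') := by
      rw [image_step_Iic, image_step_Iic]
      ext b
      obtain ⟨a, rfl⟩ := Θ.surjective b
      simp only [Θ.injective.mem_set_image, Set.mem_ofPred_eq, hval, hΘ, Subtype.coe_inj,
        hθ.1.eq_iff]
      simp only [Subtype.ext_iff]
    rw [← Set.ncard_image_of_injective _ (step_injective hpq),
      ← Set.ncard_image_of_injective (Set.Iic (θ y : X')) (step_injective hpq'), ← himg,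
      Set.ncard_image_of_injective _ Θ.injective]
  have := Fintype.ofFinite X
  have := Fintype.ofFinite X'
  rw [Nat.card_eq_fintype_card, Nat.card_eq_fintype_card] at hcard
  let φ : X ≃o X' := (monoEquivOfFin X hcard).symm.trans (monoEquivOfFin X' rfl)
  have hφ (y : Y) : φ y = θ y := by
    have h : (Set.Iic (φ y)).ncard = (Set.Iic (θ y : X')).ncard := by
      rw [← hrank, ← φ.image_Iic, Set.ncard_image_of_injective _ φ.injective]
    have hmono : StrictMono fun x : X' => (Set.Iic x).ncard := fun _ _ hxy =>
      Set.ncard_lt_ncard (Set.Iic_ssubset_Iic.2 hxy) (Set.toFinite _)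
    exact hmono.injective h
  refine ⟨φ, Set.Subset.antisymm ?_ fun y' hy' => ?_⟩
  · rintro _ ⟨y, hy, rfl⟩
    exact hφ ⟨y, hy⟩ ▸ (θ ⟨y, hy⟩).2
  · obtain ⟨y, hy⟩ := hθ.2 ⟨y', hy'⟩
    exact ⟨y, y.2, by rw [hφ, hy]⟩

/-- Conjugation by an order-isomorphism carrying `Y` to `Y'`. -/
def congr (φ : X ≃o X') (h : φ '' Y = Y') : OXY X Y ≃* OXY X' Y' where
  toFun a := ⟨(φ : X →o X').comp (a.1.comp (φ.symm : X' →o X)), fun x =>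
    h ▸ Set.mem_image_of_mem φ (a.2 (φ.symm x))⟩
  invFun b := ⟨(φ.symm : X' →o X).comp (b.1.comp (φ : X →o X')), fun x => by
    obtain ⟨y, hy, hyx⟩ := h.superset (b.2 (φ x))
    have : φ.symm (b (φ x)) = y := by rw [← hyx, φ.symm_apply_apply]
    exact this ▸ hy⟩
  left_inv a := ext fun x => by simp
  right_inv b := ext fun x => by simp
  map_mul' a b := ext fun x =>
    congrArg (fun z => φ (b z)) (φ.symm_apply_apply (a (φ.symm x))).symm

/-- Reversing the order of `X` does not change the semigroup `O(X,Y)`. -/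
def dual : OXY X Y ≃* OXY Xᵒᵈ (OrderDual.ofDual ⁻¹' Y) where
  toFun a := ⟨OrderHom.dual a.1, a.2⟩
  invFun b := ⟨OrderHom.dual.symm b.1, b.2⟩
  left_inv _ := rfl
  right_inv _ := rfl
  map_mul' _ _ := rfl

end OXY

/-- For finite chains `X, X'` and nonempty `Y ⊆ X`, `Y' ⊆ X'`, the semigroups
`O(X,Y)` and `O(X',Y')` are isomorphic iff (1) `|Y| = |Y'| = 1`, or (2) there is an
order-isomorphism `φ : X → X'` with `φ(Y) = Y'`, or (3) there is an
order-anti-isomorphism `φ : X → X'` with `φ(Y) = Y'`. -/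
theorem iso_OXY_iff_finite
    {X X' : Type*} [LinearOrder X] [LinearOrder X'] [Fintype X] [Fintype X']
    (Y : Set X) (Y' : Set X') (hY : Y.Nonempty) (hY' : Y'.Nonempty) :
    (∃ Θ : OXY X Y → OXY X' Y', Function.Bijective Θ ∧
        ∀ a b, Θ (OXY.mul a b) = OXY.mul (Θ a) (Θ b)) ↔
    ((Y.ncard = 1 ∧ Y'.ncard = 1) ∨
     (∃ φ : X → X', Function.Bijective φ ∧ (∀ a b, a ≤ b ↔ φ a ≤ φ b) ∧
        φ '' Y = Y') ∨
     (∃ φ : X → X', Function.Bijective φ ∧ (∀ a b, a ≤ b ↔ φ b ≤ φ a) ∧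
        φ '' Y = Y')) := by
  have := hY.to_subtype
  have := hY'.to_subtype
  rw [← OXY.nonempty_mulEquiv_iff]
  constructor
  · rintro ⟨Θ⟩
    obtain ⟨θ, hθ, hΘ⟩ := OXY.exists_bijective_apply Θ
    rcases subsingleton_or_nontrivial Y with hsub | hnon
    · have h : Y.ncard = 1 := Nat.card_eq_one_iff_unique.2 ⟨hsub, inferInstance⟩
      exact Or.inl ⟨h, (Nat.card_eq_of_bijective θ hθ).symm.trans h⟩
    · obtain ⟨p, q, hpq⟩ := exists_pair_lt Y
      rcases (hθ.1.ne hpq.ne).lt_or_gt with h | h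
      · obtain ⟨φ, hφ⟩ := OXY.exists_orderIso hΘ hθ hpq h
        exact Or.inr (Or.inl ⟨φ, φ.bijective, fun a b => φ.le_iff_le.symm, hφ⟩)
      · obtain ⟨φ, hφ⟩ := OXY.exists_orderIso (Θ := Θ.trans OXY.dual)
          (Y' := OrderDual.ofDual ⁻¹' Y') (θ := θ) hΘ hθ hpq h
        exact Or.inr (Or.inr ⟨φ, φ.bijective, fun a b => φ.le_iff_le.symm, hφ⟩)
  · rintro (⟨h, h'⟩ | ⟨φ, hφ, hle, himg⟩ | ⟨φ, hφ, hle, himg⟩)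
    · obtain ⟨y, rfl⟩ := Set.ncard_eq_one.1 h
      obtain ⟨y', rfl⟩ := Set.ncard_eq_one.1 h'
      exact ⟨{ toFun := fun _ => OXY.const ⟨y', rfl⟩
               invFun := fun _ => OXY.const ⟨y, rfl⟩
               left_inv := fun a => OXY.ext fun x => (a.2 x).symm
               right_inv := fun a => OXY.ext fun x => (a.2 x).symm
               map_mul' := fun _ _ => rfl }⟩
    · exact ⟨OXY.congr { Equiv.ofBijective φ hφ with map_rel_iff' := (hle _ _).symm } himg⟩
    · let e : X ≃o X'ᵒᵈ :=
        { (Equiv.ofBijective φ hφ).trans OrderDual.toDual with map_rel_iff' := (hle _ _).symm }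
      have he : e '' Y = OrderDual.ofDual ⁻¹' Y' := himg
      exact ⟨(OXY.congr e he).trans OXY.dual.symm⟩
end
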